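/- (ℓ = 0 relationship with time scalar, SO(3) case) For all φ, ρ ∈ ℝ³ and τ ∈ ℝ, the 3×3 matrix identity Γ₀(φ^∧, ρ^∧, φ^∧, τ) = ((Γ₁(φ^∧) − Γ₂(φ^∧))·ρ)^∧ · Γ₀(φ^∧) · τ holds; that is, ∑_{m=0}^∞ ∑_{n=0}^∞ ((m+1)/(m+n+2)!) τ·(φ^∧)^m ρ^∧ (φ^∧)^n = τ·((Γ₁(φ^∧) − Γ₂(φ^∧))·ρ)^∧ · exp(φ^∧). -/

import Mathlib

/-- The hat (skew-symmetric) map on `ℝ³`. -/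
def hat (φ : Fin 3 → ℝ) : Matrix (Fin 3) (Fin 3) ℝ :=
  !![0, -φ 2, φ 1; φ 2, 0, -φ 0; -φ 1, φ 0, 0]

/-- `Γ_ℓ(X) = ∑_{m=0}^∞ X^m / (ℓ+m)!` for a square real matrix. -/
noncomputable def Gamma {n : Type*} [Fintype n] [DecidableEq n]
    (ℓ : ℕ) (X : Matrix n n ℝ) : Matrix n n ℝ :=
  ∑' m : ℕ, (((ℓ + m).factorial : ℝ))⁻¹ • X ^ m

/-- `Γ_ℓ(X, Y, Z, τ) = ∑_{m=0}^∞ ∑_{n=0}^∞ ((m+1)/(ℓ+m+n+2)!) τ X^m Y Z^n`. -/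
noncomputable def Gamma4 {n : Type*} [Fintype n] [DecidableEq n]
    (ℓ : ℕ) (X Y Z : Matrix n n ℝ) (τ : ℝ) : Matrix n n ℝ :=
  ∑' m : ℕ, ∑' k : ℕ,
    ((((m : ℝ) + 1) / ((ℓ + m + k + 2).factorial : ℝ)) * τ) • (X ^ m * Y * Z ^ k)

open Finset LinearMap in
/-- The two expansions of the degree `N` part of `∫₀¹ s e^{sa} e^{(1-s)b} ds` for commuting `a, b`. -/
lemma Commute.sum_choose_mul_sub_pow_mul_pow {R : Type*} [Ring R] {a b : R} (h : Commute a b)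
    (N : ℕ) :
    ∑ p ∈ range (N + 1), (((N + 2).choose (p + 2) * (p + 1) : ℕ) : R) *
        ((a - b) ^ p * b ^ (N - p)) =
      ∑ m ∈ range (N + 1), ((m + 1 : ℕ) : R) * (a ^ m * b ^ (N - m)) := by
  induction N with
  | zero => simp
  | succ N ih =>
    have hd : Commute (a - b) b := h.sub_left (Commute.refl b)
    have key : ∀ c : ℕ → ℕ, ∀ x : R,
        ∑ p ∈ range (N + 1), (c p : R) * (x ^ p * b ^ (N + 1 - p)) =
          (∑ p ∈ range (N + 1), (c p : R) * (x ^ p * b ^ (N - p))) * b := by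
      intro c x
      rw [sum_mul]
      refine sum_congr rfl fun p hp => ?_
      rw [Nat.succ_sub (Nat.le_of_lt_succ (mem_range.mp hp)), pow_succ]
      simp only [mul_assoc]
    have pascal : ∀ p, (N + 1 + 2).choose (p + 2) * (p + 1) =
        (N + 2).choose (p + 2) * (p + 1) + (N + 2) * (N + 1).choose p := by
      intro p
      have := Nat.add_one_mul_choose_eq (N + 1) p
      rw [show N + 1 + 2 = (N + 2) + 1 by ring, Nat.choose_succ_succ' (N + 2) (p + 1)]
      linarith
    have binom : ∑ p ∈ range (N + 1 + 1), (((N + 2) * (N + 1).choose p : ℕ) : R) *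
        ((a - b) ^ p * b ^ (N + 1 - p)) = ((N + 2 : ℕ) : R) * a ^ (N + 1) := by
      have hp := hd.add_pow (N + 1)
      rw [sub_add_cancel] at hp
      rw [hp, mul_sum]
      refine sum_congr rfl fun p _ => ?_
      rw [Nat.cast_mul, mul_assoc, (Nat.cast_commute ((N + 1).choose p) _).eq]
    have split : ∀ p, (((N + 1 + 2).choose (p + 2) * (p + 1) : ℕ) : R) =
        (((N + 2).choose (p + 2) * (p + 1) : ℕ) : R) + (((N + 2) * (N + 1).choose p : ℕ) : R) :=
      fun p => by rw [pascal, Nat.cast_add]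
    rw [sum_congr rfl fun p _ => by rw [split, add_mul], sum_add_distrib, binom, sum_range_succ, sum_range_succ _ (N + 1), key, key, ih]
    simp [add_assoc]

section NormedAlgebra

open Finset LinearMap

variable {A : Type*} [NormedRing A] [NormedAlgebra ℝ A]

lemma norm_commutator_pow_le (X Y : A) (p : ℕ) :
    ‖((mulLeft ℝ X - mulRight ℝ X) ^ p) Y‖ ≤ (2 * ‖X‖) ^ p * ‖Y‖ := by
  induction p with
  | zero => simp
  | succ p ih =>
    rw [pow_succ', Module.End.mul_apply, LinearMap.sub_apply, mulLeft_apply, mulRight_apply]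
    refine (norm_sub_le _ _).trans ?_
    have h₁ := norm_mul_le X (((mulLeft ℝ X - mulRight ℝ X) ^ p) Y)
    have h₂ := norm_mul_le (((mulLeft ℝ X - mulRight ℝ X) ^ p) Y) X
    have h₃ := mul_le_mul_of_nonneg_left ih (norm_nonneg X)
    rw [pow_succ]
    linarith

lemma inv_factorial_sub_inv_factorial (p : ℕ) :
    (((1 + p).factorial : ℝ))⁻¹ - (((2 + p).factorial : ℝ))⁻¹ = (p + 1) / ((p + 2).factorial : ℝ) := by
  have h := Nat.cast_ne_zero (R := ℝ) |>.mpr (Nat.factorial_ne_zero (p + 1))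
  rw [add_comm 1, add_comm 2, Nat.factorial_succ (p + 1)]
  push_cast
  field_simp
  ring

lemma add_one_div_factorial_le (m k : ℕ) :
    ((m : ℝ) + 1) / ((m + k + 2).factorial : ℝ) ≤
      ((m.factorial : ℝ))⁻¹ * ((k.factorial : ℝ))⁻¹ := by
  rw [← mul_inv, div_le_iff₀ (by positivity), ← div_eq_inv_mul, le_div_iff₀ (by positivity)]
  have h₁ := Nat.le_of_dvd (Nat.factorial_pos _) (Nat.factorial_mul_factorial_dvd_factorial_add m k)
  have h₂ : (m + 1) * (m + k).factorial ≤ (m + k + 2).factorial := by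
    rw [Nat.factorial_succ, Nat.factorial_succ]
    nlinarith [Nat.factorial_pos (m + k), Nat.zero_le ((m+k) * (m + k).factorial),
      Nat.zero_le ((m+k)*(m+k) * (m + k).factorial), Nat.zero_le (k * (m + k).factorial)]
  exact_mod_cast (Nat.mul_le_mul_left (m + 1) h₁).trans h₂

lemma summable_add_one_div_factorial_smul [CompleteSpace A] (X Y Z : A) :
    Summable fun x : ℕ × ℕ =>
      (((x.1 : ℝ) + 1) / ((x.1 + x.2 + 2).factorial : ℝ)) • (X ^ x.1 * Y * Z ^ x.2) := by
  have hexp : ∀ X : A, Summable fun m : ℕ => ‖((m.factorial : ℝ))⁻¹ • X ^ m‖ :=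
    fun X => NormedSpace.norm_expSeries_summable' (𝕂 := ℝ) X
  have hs := ((hexp X).mul_of_nonneg (hexp Z) (fun _ => norm_nonneg _)
    (fun _ => norm_nonneg _)).mul_left ‖Y‖
  refine hs.of_norm_bounded fun x => ?_
  rw [norm_smul, norm_smul, norm_smul, Real.norm_of_nonneg (by positivity),
    Real.norm_of_nonneg (by positivity), Real.norm_of_nonneg (by positivity)]
  calc _ ≤ (((x.1.factorial : ℝ))⁻¹ * ((x.2.factorial : ℝ))⁻¹) *
        (‖X ^ x.1‖ * ‖Y‖ * ‖Z ^ x.2‖) := by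
        gcongr
        · exact add_one_div_factorial_le _ _
        · exact (norm_mul_le _ _).trans (by gcongr; exact norm_mul_le _ _)
    _ = _ := by ring

lemma sum_antidiagonal_commutator_pow (X Y : A) (N : ℕ) :
    ∑ x ∈ antidiagonal N, (((x.1 : ℝ) + 1) / ((x.1 + 2).factorial : ℝ)) •
        ((mulLeft ℝ X - mulRight ℝ X) ^ x.1) Y * ((x.2.factorial : ℝ)⁻¹ • X ^ x.2) =
      ∑ x ∈ antidiagonal N,
        (((x.1 : ℝ) + 1) / ((x.1 + x.2 + 2).factorial : ℝ)) • (X ^ x.1 * Y * X ^ x.2) := by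
  have hc : Commute (mulLeft ℝ X) (mulRight ℝ X) := LinearMap.commute_mulLeft_right X X
  have hd : Commute (mulLeft ℝ X - mulRight ℝ X) (mulRight ℝ X) :=
    hc.sub_left (Commute.refl _)
  have key := congrArg (fun T : Module.End ℝ A => (((N + 2).factorial : ℝ))⁻¹ • T Y)
    (hc.sum_choose_mul_sub_pow_mul_pow N)
  simp only [LinearMap.sum_apply, smul_sum] at key
  rw [Nat.sum_antidiagonal_eq_sum_range_succ_mk, Nat.sum_antidiagonal_eq_sum_range_succ_mk]
  convert key using 2 with p hp p hp
  · have hp' : p ≤ N := Nat.le_of_lt_succ (mem_range.mp hp)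
    rw [(hd.pow_pow p (N - p)).eq, ← nsmul_eq_mul, LinearMap.smul_apply, Module.End.mul_apply,
      pow_mulRight, mulRight_apply, smul_mul_smul_comm, ← Nat.cast_smul_eq_nsmul ℝ, smul_smul]
    congr 1
    rw [Nat.cast_mul, Nat.cast_choose ℝ (show p + 2 ≤ N + 2 by omega),
      show N + 2 - (p + 2) = N - p by omega]
    have := Nat.cast_ne_zero (R := ℝ) |>.mpr (Nat.factorial_ne_zero (N + 2))
    field_simp
    push_cast
    ring
  · have hp' : p ≤ N := Nat.le_of_lt_succ (mem_range.mp hp)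
    rw [← nsmul_eq_mul, LinearMap.smul_apply, Module.End.mul_apply, pow_mulRight, pow_mulLeft,
      mulRight_apply, mulLeft_apply, ← Nat.cast_smul_eq_nsmul ℝ, smul_smul, mul_assoc,
      Nat.add_sub_cancel' hp']
    congr 1
    push_cast
    ring

lemma summable_norm_commutator_pow (X Y : A) :
    Summable fun p : ℕ => ‖(((p : ℝ) + 1) / ((p + 2).factorial : ℝ)) •
      ((mulLeft ℝ X - mulRight ℝ X) ^ p) Y‖ := by
  refine Summable.of_nonneg_of_le (fun _ => norm_nonneg _) (fun p => ?_)
    ((Real.summable_pow_div_factorial (2 * ‖X‖)).mul_right ‖Y‖)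
  rw [norm_smul, Real.norm_of_nonneg (by positivity)]
  calc _ ≤ ((p.factorial : ℝ))⁻¹ * ((2 * ‖X‖) ^ p * ‖Y‖) := by
        gcongr
        · simpa using add_one_div_factorial_le p 0
        · exact norm_commutator_pow_le X Y p
    _ = _ := by ring

lemma tsum_tsum_add_one_div_factorial_smul [CompleteSpace A] (X Y : A) :
    ∑' m : ℕ, ∑' k : ℕ, (((m : ℝ) + 1) / ((m + k + 2).factorial : ℝ)) • (X ^ m * Y * X ^ k) =
      (∑' p : ℕ, (((p : ℝ) + 1) / ((p + 2).factorial : ℝ)) •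
        ((mulLeft ℝ X - mulRight ℝ X) ^ p) Y) * ∑' q : ℕ, ((q.factorial : ℝ))⁻¹ • X ^ q := by
  have hs := summable_add_one_div_factorial_smul X Y X
  rw [tsum_mul_tsum_eq_tsum_sum_antidiagonal_of_summable_norm (summable_norm_commutator_pow X Y)
      (NormedSpace.norm_expSeries_summable' (𝕂 := ℝ) X)]
  simp only [sum_antidiagonal_commutator_pow]
  refine hs.tsum_prod.symm.trans ?_
  rw [← Equiv.tsum_eq (HasAntidiagonal.sigmaAntidiagonalEquivProd (A := ℕ))]
  refine (HasAntidiagonal.sigmaAntidiagonalEquivProd.summable_iff.mpr hs).tsum_sigma.trans ?_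
  refine tsum_congr fun N => ?_
  rw [tsum_fintype]
  exact Finset.sum_coe_sort (antidiagonal N) fun x =>
    (((x.1 : ℝ) + 1) / ((x.1 + x.2 + 2).factorial : ℝ)) • (X ^ x.1 * Y * X ^ x.2)

end NormedAlgebra

/-- The hat map as a linear map. -/
def hatLinearMap : (Fin 3 → ℝ) →ₗ[ℝ] Matrix (Fin 3) (Fin 3) ℝ where
  toFun := hat
  map_add' u v := by
    ext i j
    fin_cases i <;> fin_cases j <;> simp [hat] <;> ring
  map_smul' c v := by
    ext i j
    fin_cases i <;> fin_cases j <;> simp [hat]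

lemma hat_mulVec (φ ρ : Fin 3 → ℝ) :
    hat ((hat φ).mulVec ρ) = hat φ * hat ρ - hat ρ * hat φ := by
  ext i j
  fin_cases i <;> fin_cases j <;>
    simp [hat, Matrix.mulVec, dotProduct, Fin.sum_univ_three] <;> ring

lemma hat_pow_mulVec (φ ρ : Fin 3 → ℝ) (p : ℕ) :
    hat ((hat φ ^ p).mulVec ρ) =
      ((LinearMap.mulLeft ℝ (hat φ) - LinearMap.mulRight ℝ (hat φ)) ^ p) (hat ρ) := by
  induction p with
  | zero => simp
  | succ p ih =>
    rw [pow_succ', ← Matrix.mulVec_mulVec, hat_mulVec, ih, pow_succ' (_ - _), Module.End.mul_apply]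
    rfl

section Matrix

attribute [local instance] Matrix.linftyOpNormedRing Matrix.linftyOpNormedAlgebra

lemma summable_gamma {n : Type*} [Fintype n] [DecidableEq n] (ℓ : ℕ) (X : Matrix n n ℝ) :
    Summable fun m : ℕ => (((ℓ + m).factorial : ℝ))⁻¹ • X ^ m := by
  refine Summable.of_norm_bounded (NormedSpace.norm_expSeries_summable' (𝕂 := ℝ) X) fun m => ?_
  rw [norm_smul, norm_smul, Real.norm_of_nonneg (by positivity), Real.norm_of_nonneg (by positivity)]
  gcongr
  omega

lemma hat_gamma_sub_mulVec (φ ρ : Fin 3 → ℝ) :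
    hat ((Gamma 1 (hat φ) - Gamma 2 (hat φ)).mulVec ρ) =
      ∑' p : ℕ, (((p : ℝ) + 1) / ((p + 2).factorial : ℝ)) •
        ((LinearMap.mulLeft ℝ (hat φ) - LinearMap.mulRight ℝ (hat φ)) ^ p) (hat ρ) := by
  have h := (summable_gamma 1 (hat φ)).hasSum.sub (summable_gamma 2 (hat φ)).hasSum
  let L : Matrix (Fin 3) (Fin 3) ℝ →ₗ[ℝ] Matrix (Fin 3) (Fin 3) ℝ :=
    hatLinearMap ∘ₗ (Matrix.mulVecBilin ℝ ℝ).flip ρ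
  have hL := h.map L L.continuous_of_finiteDimensional
  refine hL.tsum_eq.symm.trans (tsum_congr fun p => ?_)
  rw [Function.comp_apply]
  rw [← sub_smul, inv_factorial_sub_inv_factorial, map_smul, ← hat_pow_mulVec]
  rfl

lemma gamma4_zero_eq_smul (φ ρ : Fin 3 → ℝ) (τ : ℝ) :
    Gamma4 0 (hat φ) (hat ρ) (hat φ) τ =
      τ • (hat ((Gamma 1 (hat φ) - Gamma 2 (hat φ)).mulVec ρ) * Gamma 0 (hat φ)) := by
  rw [hat_gamma_sub_mulVec]
  simp only [Gamma4, Gamma, zero_add, mul_comm _ τ, mul_smul, tsum_const_smul'']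
  exact congrArg (τ • ·) (tsum_tsum_add_one_div_factorial_smul (hat φ) (hat ρ))

end Matrix

theorem gamma4_zero_eq (φ ρ : Fin 3 → ℝ) (τ : ℝ) :
    Gamma4 0 (hat φ) (hat ρ) (hat φ) τ =
      τ • (hat ((Gamma 1 (hat φ) - Gamma 2 (hat φ)).mulVec ρ) * Gamma 0 (hat φ)) := by
  exact gamma4_zero_eq_smul φ ρ τ
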